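/- Let ε > 0, ξ ≥ 0, let f : ℝⁿ → ℝ be a smooth ℤⁿ-periodic function whose Hessian D²f(x) is positive semidefinite at every x, and let u : ℝⁿ → ℝ be a smooth ℤⁿ-periodic function. Writing v = v(∇u) and Δ_f u = Δu − ∇f·∇u, one has ∫_{[0,1]ⁿ} [ −2(1+ε)(Δ_f u)² + (v·D²u v)(Δ_f u) + 2ξ|∇u|² + |D²u v|² ] dμ ≤ −2ε ∫_{[0,1]ⁿ} (|D²u|² + |∇u|²) dμ + 2(ε+ξ) ∫_{[0,1]ⁿ} |∇u|² dμ. -/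

import Mathlib

noncomputable section

open MeasureTheory

variable {n : ℕ}

/-- `i`-th partial derivative. -/
def pderiv1 (u : (Fin n → ℝ) → ℝ) (i : Fin n) (x : Fin n → ℝ) : ℝ :=
  fderiv ℝ u x (Pi.single i 1)

/-- Gradient. -/
def grad (u : (Fin n → ℝ) → ℝ) (x : Fin n → ℝ) : Fin n → ℝ :=
  fun i => pderiv1 u i x

/-- Hessian matrix. -/
def hess (u : (Fin n → ℝ) → ℝ) (x : Fin n → ℝ) : Matrix (Fin n) (Fin n) ℝ :=
  Matrix.of fun i j => pderiv1 (pderiv1 u j) i x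

/-- Laplacian. -/
def lap (u : (Fin n → ℝ) → ℝ) (x : Fin n → ℝ) : ℝ :=
  ∑ i, pderiv1 (pderiv1 u i) i x

/-- Euclidean dot product. -/
def dot (a b : Fin n → ℝ) : ℝ := ∑ i, a i * b i

/-- ℤⁿ-periodicity. -/
def ZPeriodic (u : (Fin n → ℝ) → ℝ) : Prop :=
  ∀ (x : Fin n → ℝ) (k : Fin n → ℤ), u (x + fun i => (k i : ℝ)) = u x

/-- Area element `Q(p) = √(1+|p|²)`. -/
def Qe (p : Fin n → ℝ) : ℝ := Real.sqrt (1 + ∑ i, p i ^ 2)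

/-- `v(p) = p / √(1+|p|²)`. -/
def vv (p : Fin n → ℝ) : Fin n → ℝ := fun i => p i / Qe p

/-- Divergence of a vector field. -/
def dvg (V : (Fin n → ℝ) → (Fin n → ℝ)) (x : Fin n → ℝ) : ℝ :=
  ∑ i, fderiv ℝ (fun y => V y i) x (Pi.single i 1)

/-- Weighted divergence `div_f V = div V − ∇f·V`. -/
def divf (f : (Fin n → ℝ) → ℝ) (V : (Fin n → ℝ) → (Fin n → ℝ)) (x : Fin n → ℝ) : ℝ :=
  dvg V x - dot (grad f x) (V x)

/-- Frobenius inner product of matrices. -/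
def frob (A B : Matrix (Fin n) (Fin n) ℝ) : ℝ := ∑ i, ∑ j, A i j * B i j

theorem ContDiff.smooth_pderiv1 {g : (Fin n → ℝ) → ℝ} (hg : ContDiff ℝ (⊤ : ℕ∞) g) (i : Fin n) :
    ContDiff ℝ (⊤ : ℕ∞) (pderiv1 g i) :=
  (hg.fderiv_right (m := (⊤ : ℕ∞)) (by norm_cast)).clm_apply contDiff_const

theorem ZPeriodic.periodic_pderiv1 {g : (Fin n → ℝ) → ℝ} (hg : ZPeriodic g) (i : Fin n) :
    ZPeriodic (pderiv1 g i) := by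
  intro x k
  unfold pderiv1
  rw [← fderiv_comp_add_right]
  congr 2
  funext y
  exact hg y k

theorem ZPeriodic.add_single {g : (Fin n → ℝ) → ℝ} (hg : ZPeriodic g) (i : Fin n)
    (x : Fin n → ℝ) : g (x + Pi.single i 1) = g x := by
  have h := hg x (Pi.single i 1)
  have e : (fun j => ((Pi.single i 1 : Fin n → ℤ) j : ℝ)) = Pi.single i 1 := by
    funext j
    by_cases h : j = i
    · subst h; simp
    · simp [h]
  rwa [e] at h

theorem ZPeriodic.mul {g h : (Fin n → ℝ) → ℝ} (hg : ZPeriodic g) (hh : ZPeriodic h) :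
    ZPeriodic (fun x => g x * h x) := fun x k => by
  simp only [hg x k, hh x k]

/-- A partial derivative of a smooth periodic function has vanishing integral. -/
theorem ZPeriodic.integral_pderiv1_eq_zero {g : (Fin n → ℝ) → ℝ} (hg : ContDiff ℝ (⊤ : ℕ∞) g)
    (hp : ZPeriodic g) (i : Fin n) :
    ∫ x in Set.Icc (0 : Fin n → ℝ) 1, pderiv1 g i x = 0 := by
  obtain _ | m := n
  · exact i.elim0
  have hd : Differentiable ℝ g := hg.differentiable (by simp)
  have hsum : ∀ x, ∑ j, (if j = i then fderiv ℝ g x else 0) (Pi.single j 1)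
      = pderiv1 g i x := fun x => by
    rw [Finset.sum_eq_single i (fun j _ hj => by simp [hj]) (by simp)]
    simp [pderiv1]
  have key := integral_divergence_of_hasFDerivAt_off_countable' (0 : Fin (m + 1) → ℝ) 1
    zero_le_one (fun j => if j = i then g else 0)
    (fun j x => if j = i then fderiv ℝ g x else 0) ∅ Set.countable_empty
    (fun j => by
      split_ifs
      · exact hg.continuous.continuousOn
      · exact continuousOn_const)
    (fun x _ j => by
      by_cases h : j = i
      · simpa [h] using (hd x).hasFDerivAt
      · simpa only [h, if_false] using hasFDerivAt_zero x)
    (by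
      simp only [hsum]
      exact (hg.smooth_pderiv1 i).continuous.continuousOn.integrableOn_compact isCompact_Icc)
  simp only [hsum] at key
  rw [key, Finset.sum_eq_single i (fun j _ hj => by simp [hj]) (by simp)]
  rw [sub_eq_zero]
  refine setIntegral_congr_fun measurableSet_Icc fun y _ => ?_
  simp only [if_true]
  rw [← hp.add_single i (Fin.insertNth i ((0 : Fin (m + 1) → ℝ) i) y)]
  congr 1
  funext j
  refine Fin.succAboveCases i ?_ (fun k => ?_) j <;> simp

theorem pderiv1_comm {g : (Fin n → ℝ) → ℝ} (hg : ContDiff ℝ (⊤ : ℕ∞) g) (i j : Fin n)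
    (x : Fin n → ℝ) : pderiv1 (pderiv1 g i) j x = pderiv1 (pderiv1 g j) i x := by
  have hd : DifferentiableAt ℝ (fderiv ℝ g) x :=
    ((hg.fderiv_right (m := (⊤ : ℕ∞)) (by norm_cast)).differentiable (by simp)) x
  have h : ∀ a b : Fin n, pderiv1 (pderiv1 g a) b x
      = fderiv ℝ (fderiv ℝ g) x (Pi.single b 1) (Pi.single a 1) := fun a b => by
    change fderiv ℝ (fun y => fderiv ℝ g y (Pi.single a 1)) x (Pi.single b 1) = _
    rw [fderiv_clm_apply hd (differentiableAt_const _)]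
    simp
  rw [h, h]
  exact (hg.contDiffAt.isSymmSndFDerivAt (by
    rw [minSmoothness_of_isRCLikeNormedField]; norm_cast)) _ _

theorem pderiv1_mul {g h : (Fin n → ℝ) → ℝ} {x : Fin n → ℝ} (hg : DifferentiableAt ℝ g x)
    (hh : DifferentiableAt ℝ h x) (i : Fin n) :
    pderiv1 (fun y => g y * h y) i x = g x * pderiv1 h i x + h x * pderiv1 g i x := by
  simp [pderiv1, fderiv_fun_mul hg hh]

/-- Integrating by parts twice, `∫ |D²u|² = ∫ (Δu)²` on the torus. -/
theorem ZPeriodic.integral_frob_hess_sub_lap_sq {u : (Fin n → ℝ) → ℝ}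
    (hu : ContDiff ℝ (⊤ : ℕ∞) u) (hp : ZPeriodic u) :
    ∫ x in Set.Icc (0 : Fin n → ℝ) 1, (frob (hess u x) (hess u x) - lap u x ^ 2) = 0 := by
  have hs := fun i : Fin n => hu.smooth_pderiv1 i
  have hss := fun i j : Fin n => (hs i).smooth_pderiv1 j
  have hA : ∀ i j, ContDiff ℝ (⊤ : ℕ∞)
      (fun y => pderiv1 u i y * pderiv1 (pderiv1 u j) i y) :=
    fun i j => (hs i).mul (hss j i)
  have hB : ∀ i j, ContDiff ℝ (⊤ : ℕ∞)
      (fun y => pderiv1 u i y * pderiv1 (pderiv1 u j) j y) :=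
    fun i j => (hs i).mul (hss j j)
  have hdiff : ∀ {g : (Fin n → ℝ) → ℝ}, ContDiff ℝ (⊤ : ℕ∞) g → Differentiable ℝ g :=
    fun h => h.differentiable (by simp)
  have e : ∀ x, frob (hess u x) (hess u x) - lap u x ^ 2 = ∑ i, ∑ j,
      (pderiv1 (fun y => pderiv1 u i y * pderiv1 (pderiv1 u j) i y) j x
      - pderiv1 (fun y => pderiv1 u i y * pderiv1 (pderiv1 u j) j y) i x) := by
    intro x
    simp only [frob, hess, lap, Matrix.of_apply, sq, Finset.sum_mul_sum,
      ← Finset.sum_sub_distrib]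
    refine Finset.sum_congr rfl fun i _ => Finset.sum_congr rfl fun j _ => ?_
    rw [pderiv1_mul (hdiff (hs i) x) (hdiff (hss j i) x),
      pderiv1_mul (hdiff (hs i) x) (hdiff (hss j j) x),
      pderiv1_comm (hs j) i j, pderiv1_comm hu i j]
    ring
  have hint : ∀ {g : (Fin n → ℝ) → ℝ} (i : Fin n), ContDiff ℝ (⊤ : ℕ∞) g →
      IntegrableOn (pderiv1 g i) (Set.Icc (0 : Fin n → ℝ) 1) := fun i h =>
    (h.smooth_pderiv1 i).continuous.continuousOn.integrableOn_compact isCompact_Icc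
  simp only [e]
  have hsub := fun i j => (hint j (hA i j)).sub (hint i (hB i j))
  refine (integral_finsetSum _ fun i _ => integrable_finsetSum _ fun j _ => hsub i j).trans
    (Finset.sum_eq_zero fun i _ => (integral_finsetSum _ fun j _ => hsub i j).trans ?_)
  refine Finset.sum_eq_zero fun j _ => ?_
  refine (integral_sub (hint j (hA i j)) (hint i (hB i j))).trans ?_
  rw [ZPeriodic.integral_pderiv1_eq_zero (hA i j)
      ((hp.periodic_pderiv1 i).mul ((hp.periodic_pderiv1 j).periodic_pderiv1 i)),
    ZPeriodic.integral_pderiv1_eq_zero (hB i j)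
      ((hp.periodic_pderiv1 i).mul ((hp.periodic_pderiv1 j).periodic_pderiv1 j)),
    sub_zero]

/-- A periodic function that is convex in each coordinate direction is a constant. -/
theorem ZPeriodic.pderiv1_eq_zero {f : (Fin n → ℝ) → ℝ} (hf : ContDiff ℝ (⊤ : ℕ∞) f)
    (hp : ZPeriodic f) (i : Fin n) (hconv : ∀ x, 0 ≤ pderiv1 (pderiv1 f i) i x)
    (x : Fin n → ℝ) : pderiv1 f i x = 0 := by
  have hline : ∀ {g : (Fin n → ℝ) → ℝ}, ContDiff ℝ (⊤ : ℕ∞) g → ∀ t : ℝ,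
      HasDerivAt (fun s : ℝ => g (x + s • Pi.single i 1))
        (pderiv1 g i (x + t • Pi.single i 1)) t := fun {g} hg t => by
    have h1 : HasDerivAt (fun s : ℝ => x + s • (Pi.single i 1 : Fin n → ℝ)) (Pi.single i 1) t := by
      simpa using ((hasDerivAt_id t).smul_const (Pi.single i 1 : Fin n → ℝ)).const_add x
    exact ((hg.differentiable (by simp)) _).hasFDerivAt.comp_hasDerivAt t h1
  have hmono : Monotone fun s : ℝ => pderiv1 f i (x + s • Pi.single i 1) :=
    monotone_of_hasDerivAt_nonneg (hline (hf.smooth_pderiv1 i)) fun t => hconv _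
  have hcont : Continuous fun s : ℝ => f (x + s • Pi.single i 1) :=
    continuous_iff_continuousAt.2 fun t => (hline hf t).continuousAt
  obtain ⟨c, hc, hc0⟩ := exists_hasDerivAt_eq_zero (zero_lt_one' ℝ) hcont.continuousOn
    (by simpa using (hp.add_single i x).symm) fun t _ => hline hf t
  obtain ⟨d, hd, hd0⟩ := exists_hasDerivAt_eq_zero (neg_lt_zero.2 (zero_lt_one' ℝ))
    hcont.continuousOn
    (by
      have h := hp.add_single i (x - Pi.single i 1)
      rw [sub_add_cancel] at h
      simpa [← sub_eq_add_neg] using h.symm)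
    fun t _ => hline hf t
  have h1 := hmono hc.1.le
  have h2 := hmono hd.2.le
  simp only [zero_smul, add_zero, hc0, hd0] at h1 h2
  exact le_antisymm h1 h2

theorem eq_of_pderiv1_eq_zero {f : (Fin n → ℝ) → ℝ} (hf : Differentiable ℝ f)
    (h : ∀ i x, pderiv1 f i x = 0) (x y : Fin n → ℝ) : f x = f y := by
  refine is_const_of_fderiv_eq_zero hf (fun z => ?_) x y
  refine ContinuousLinearMap.coe_injective (LinearMap.pi_ext' fun i => ?_)
  ext
  simpa [pderiv1] using h i z

theorem Qe_pos (p : Fin n → ℝ) : 0 < Qe p :=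
  Real.sqrt_pos.2 (add_pos_of_pos_of_nonneg one_pos (Finset.sum_nonneg fun _ _ => sq_nonneg _))

theorem sum_vv_sq_le_one (p : Fin n → ℝ) : ∑ i, vv p i ^ 2 ≤ 1 := by
  have h0 : 0 ≤ ∑ i, p i ^ 2 := Finset.sum_nonneg fun _ _ => sq_nonneg _
  have hQ : Qe p ^ 2 = 1 + ∑ i, p i ^ 2 := Real.sq_sqrt (by linarith)
  simp only [vv, div_pow, ← Finset.sum_div]
  rw [hQ, div_le_one (by linarith)]
  linarith

theorem sum_mulVec_sq_le (A : Matrix (Fin n) (Fin n) ℝ) {w : Fin n → ℝ}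
    (hw : ∑ i, w i ^ 2 ≤ 1) : ∑ i, (A.mulVec w i) ^ 2 ≤ frob A A := by
  refine Finset.sum_le_sum fun i _ => ?_
  simp only [← sq]
  exact (Finset.sum_mul_sq_le_sq_mul_sq _ _ _).trans
    (mul_le_of_le_one_right (Finset.sum_nonneg fun _ _ => sq_nonneg _) hw)

theorem dot_mulVec_sq_le (A : Matrix (Fin n) (Fin n) ℝ) {w : Fin n → ℝ}
    (hw : ∑ i, w i ^ 2 ≤ 1) : dot w (A.mulVec w) ^ 2 ≤ frob A A :=
  (Finset.sum_mul_sq_le_sq_mul_sq _ _ _).trans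
    ((mul_le_of_le_one_left (Finset.sum_nonneg fun _ _ => sq_nonneg _) hw).trans
      (sum_mulVec_sq_le A hw))

/-- The integrated estimate for abstract functions `L`, `W`, `G`, `N`, `F`, playing the roles of
`Δu`, `v·D²u v`, `|∇u|²`, `|D²u v|²` and `|D²u|²`. -/
theorem integral_le_of_pointwise_bounds {L W G N F : (Fin n → ℝ) → ℝ} (hL : Continuous L)
    (hW : Continuous W) (hG : Continuous G) (hN : Continuous N) (hF : Continuous F)
    (hFL : ∫ x in Set.Icc (0 : Fin n → ℝ) 1, (F x - L x ^ 2) = 0)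
    (hNF : ∀ x, N x ≤ F x) (hWF : ∀ x, W x ^ 2 ≤ F x) (ε ξ : ℝ) :
    ∫ x in Set.Icc (0 : Fin n → ℝ) 1,
        (-2 * (1 + ε) * L x ^ 2 + W x * L x + 2 * ξ * G x + N x) ≤
      -2 * ε * (∫ x in Set.Icc (0 : Fin n → ℝ) 1, (F x + G x))
        + 2 * (ε + ξ) * ∫ x in Set.Icc (0 : Fin n → ℝ) 1, G x := by
  have hint : ∀ {g : (Fin n → ℝ) → ℝ}, Continuous g →
      IntegrableOn g (Set.Icc (0 : Fin n → ℝ) 1) := fun h =>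
    h.continuousOn.integrableOn_compact isCompact_Icc
  have hle := integral_mono (μ := volume.restrict (Set.Icc (0 : Fin n → ℝ) 1))
    (f := fun x => -2 * (1 + ε) * L x ^ 2 + W x * L x + 2 * ξ * G x + N x)
    (g := fun x => -2 * ε * (F x + G x) + 2 * (ε + ξ) * G x
      + (2 * ε + 3 / 2) * (F x - L x ^ 2))
    (hint (by fun_prop)) (hint (by fun_prop)) fun x => by
      have h1 := hNF x
      have h2 := hWF x
      have h3 := sq_nonneg (W x - L x)
      dsimp only
      linarith
  refine hle.trans_eq ?_
  rw [integral_add (hint (by fun_prop)) (hint (by fun_prop)),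
    integral_add (hint (by fun_prop)) (hint (by fun_prop)), integral_const_mul,
    integral_const_mul, integral_const_mul, hFL, mul_zero, add_zero]

/-- coercivity estimate: for `ε > 0`, `ξ ≥ 0`, smooth periodic `f`
with `D²f ≥ 0` everywhere, and smooth periodic `u`, writing `v = v(∇u)` and
`Δ_f u = Δu − ∇f·∇u`,
`∫ [−2(1+ε)(Δ_f u)² + (v·D²u v)(Δ_f u) + 2ξ|∇u|² + |D²u v|²] dμ
  ≤ −2ε ∫ (|D²u|² + |∇u|²) dμ + 2(ε+ξ) ∫ |∇u|² dμ` with `dμ = e^{-f} dx`. -/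
theorem coercivity_estimate
    (ε ξ : ℝ) (hε : 0 < ε) (hξ : 0 ≤ ξ)
    (f u : (Fin n → ℝ) → ℝ)
    (hf : ContDiff ℝ (⊤ : ℕ∞) f) (hu : ContDiff ℝ (⊤ : ℕ∞) u)
    (hfp : ZPeriodic f) (hup : ZPeriodic u)
    (hfconv : ∀ x : Fin n → ℝ, (hess f x).PosSemidef) :
    ∫ x in Set.Icc (0 : Fin n → ℝ) 1,
        (-2 * (1 + ε) * (lap u x - dot (grad f x) (grad u x)) ^ 2
          + dot (vv (grad u x)) ((hess u x).mulVec (vv (grad u x))) *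
              (lap u x - dot (grad f x) (grad u x))
          + 2 * ξ * dot (grad u x) (grad u x)
          + ∑ i, ((hess u x).mulVec (vv (grad u x)) i) ^ 2) * Real.exp (-f x) ≤
      -2 * ε * (∫ x in Set.Icc (0 : Fin n → ℝ) 1,
            (frob (hess u x) (hess u x) + dot (grad u x) (grad u x)) * Real.exp (-f x))
        + 2 * (ε + ξ) * ∫ x in Set.Icc (0 : Fin n → ℝ) 1,
            dot (grad u x) (grad u x) * Real.exp (-f x) := by
  have hgrad : ∀ i x, pderiv1 f i x = 0 := fun i =>
    hfp.pderiv1_eq_zero hf i fun x => (hfconv x).diag_nonneg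
  have hconst : ∀ x, f x = f 0 := fun x =>
    eq_of_pderiv1_eq_zero (hf.differentiable (by simp)) hgrad x 0
  have hdot : ∀ x, dot (grad f x) (grad u x) = 0 := fun x => by simp [dot, grad, hgrad]
  simp only [hconst, hdot, sub_zero, integral_mul_const]
  have c1 : ∀ i, Continuous (pderiv1 u i) := fun i => (hu.smooth_pderiv1 i).continuous
  have c2 : ∀ i j, Continuous (pderiv1 (pderiv1 u i) j) := fun i j =>
    ((hu.smooth_pderiv1 i).smooth_pderiv1 j).continuous
  have cL : Continuous (lap u) := continuous_finsetSum _ fun i _ => c2 i i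
  have cG : Continuous fun x => dot (grad u x) (grad u x) :=
    continuous_finsetSum _ fun i _ => (c1 i).mul (c1 i)
  have cF : Continuous fun x => frob (hess u x) (hess u x) :=
    continuous_finsetSum _ fun i _ => continuous_finsetSum _ fun j _ => (c2 j i).mul (c2 j i)
  have cv : ∀ i, Continuous fun x => vv (grad u x) i := fun i =>
    (c1 i).div (Real.continuous_sqrt.comp
      (continuous_const.add (continuous_finsetSum _ fun j _ => (c1 j).pow 2)))
      fun x => (Qe_pos _).ne'
  have cHv : ∀ i, Continuous fun x => (hess u x).mulVec (vv (grad u x)) i := fun i =>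
    continuous_finsetSum Finset.univ fun j _ => (c2 j i).mul (cv j)
  have cW : Continuous fun x => dot (vv (grad u x)) ((hess u x).mulVec (vv (grad u x))) :=
    continuous_finsetSum _ fun i _ => (cv i).mul (cHv i)
  have cN : Continuous fun x => ∑ i, ((hess u x).mulVec (vv (grad u x)) i) ^ 2 :=
    continuous_finsetSum _ fun i _ => (cHv i).pow 2
  refine (mul_le_mul_of_nonneg_right (integral_le_of_pointwise_bounds cL cW cG cN cF
    (hup.integral_frob_hess_sub_lap_sq hu) (fun x => ?_) (fun x => ?_) ε ξ)
    (Real.exp_pos _).le).trans_eq (by ring)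
  · exact sum_mulVec_sq_le _ (sum_vv_sq_le_one _)
  · exact dot_mulVec_sq_le _ (sum_vv_sq_le_one _)
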